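/- If λ+μ < (q⁻/p⁺)·δ, then there exists a positive constant K = K(N,s,p,q,α,β,a,b,λ,μ,Ω) > 0 such that θ⁻_{λ,μ} := inf{J_{λ,μ}(u,v) : (u,v) ∈ N⁻_{λ,μ}} ≥ K > 0; in particular J_{λ,μ}(u,v) > 0 for every (u,v) ∈ N⁻_{λ,μ}. -/

import Mathlib

open MeasureTheory Real Set Filter Topology

noncomputable section

abbrev Euc (N : ℕ) := EuclideanSpace ℝ (Fin N)

/-- `Φ⁻ := inf_D Φ`. -/
def infOn {X : Type*} (g : X → ℝ) (D : Set X) : ℝ := sInf (g '' D)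

/-- `Φ⁺ := sup_D Φ`. -/
def supOn {X : Type*} (g : X → ℝ) (D : Set X) : ℝ := sSup (g '' D)

/-- `C₊(D)`: continuous on `D` with `1 < g⁻ ≤ g⁺ < ∞`. -/
def CPlus {X : Type*} [TopologicalSpace X] (D : Set X) (g : X → ℝ) : Prop :=
  ContinuousOn g D ∧ 1 < infOn g D ∧ BddAbove (g '' D)

variable {N : ℕ}

/-- the modular `ρ_γ(u) = ∫_Ω |u|^{γ(x)} dx`. -/
def modular (Ω : Set (Euc N)) (γ u : Euc N → ℝ) : ℝ := ∫ x in Ω, |u x| ^ γ x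

/-- membership in the variable exponent Lebesgue space `L^{γ(x)}(Ω)`. -/
def MemVarLp (Ω : Set (Euc N)) (γ u : Euc N → ℝ) : Prop :=
  AEMeasurable u (volume.restrict Ω) ∧ IntegrableOn (fun x => |u x| ^ γ x) Ω

/-- the Luxemburg norm on `L^{γ(x)}(Ω)`. -/
def luxNorm (Ω : Set (Euc N)) (γ u : Euc N → ℝ) : ℝ :=
  sInf {η : ℝ | 0 < η ∧ (∫ x in Ω, (|u x| / η) ^ γ x) ≤ 1}

/-- the scaled Gagliardo modular over a set `D ⊆ ℝ^N × ℝ^N`. -/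
def gagliardoOn (D : Set (Euc N × Euc N)) (s : ℝ) (p : Euc N × Euc N → ℝ)
    (u : Euc N → ℝ) (η : ℝ) : ℝ :=
  ∫ z in D, |u z.1 - u z.2| ^ p z / (η ^ p z * ‖z.1 - z.2‖ ^ ((N : ℝ) + s * p z))

/-- the seminorm `[u]_Ω^{s,p(x,y)}` of `W`. -/
def Wseminorm (Ω : Set (Euc N)) (s : ℝ) (p : Euc N × Euc N → ℝ) (u : Euc N → ℝ) : ℝ :=
  sInf {η : ℝ | 0 < η ∧ gagliardoOn (Ω ×ˢ Ω) s p u η < 1}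

/-- the norm of `W = W^{s,p̄(x),p(x,y)}(Ω)`. -/
def WNorm (Ω : Set (Euc N)) (s : ℝ) (p : Euc N × Euc N → ℝ) (u : Euc N → ℝ) : ℝ :=
  luxNorm Ω (fun x => p (x, x)) u + Wseminorm Ω s p u

/-- membership in `W = W^{s,p̄(x),p(x,y)}(Ω)`. -/
def MemW (Ω : Set (Euc N)) (s : ℝ) (p : Euc N × Euc N → ℝ) (u : Euc N → ℝ) : Prop :=
  Measurable u ∧ IntegrableOn (fun x => |u x| ^ p (x, x)) Ω ∧
    ∃ η > (0 : ℝ), IntegrableOn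
      (fun z : Euc N × Euc N =>
        |u z.1 - u z.2| ^ p z / (η ^ p z * ‖z.1 - z.2‖ ^ ((N : ℝ) + s * p z))) (Ω ×ˢ Ω)

/-- the modular `ρ_{X₀}`. -/
def rhoX0 (s : ℝ) (p : Euc N × Euc N → ℝ) (u : Euc N → ℝ) : ℝ :=
  ∫ z : Euc N × Euc N, |u z.1 - u z.2| ^ p z / ‖z.1 - z.2‖ ^ ((N : ℝ) + s * p z)

/-- the Luxemburg-type norm of `X₀`. -/
def X0Norm (s : ℝ) (p : Euc N × Euc N → ℝ) (u : Euc N → ℝ) : ℝ :=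
  sInf {η : ℝ | 0 < η ∧ gagliardoOn univ s p u η ≤ 1}

/-- membership in `X₀`: vanishing a.e. outside `Ω` and finite scaled Gagliardo modular. -/
def MemX0 (Ω : Set (Euc N)) (s : ℝ) (p : Euc N × Euc N → ℝ) (u : Euc N → ℝ) : Prop :=
  Measurable u ∧ (∀ᵐ x ∂(volume : Measure (Euc N)), x ∉ Ω → u x = 0) ∧
    ∃ η > (0 : ℝ), Integrable
      (fun z : Euc N × Euc N =>
        |u z.1 - u z.2| ^ p z / (η ^ p z * ‖z.1 - z.2‖ ^ ((N : ℝ) + s * p z)))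

/-- the norm `‖(u,v)‖ = max {‖u‖_{X₀}, ‖v‖_{X₀}}` on `E = X₀ × X₀`. -/
def pairNorm (s : ℝ) (p : Euc N × Euc N → ℝ) (u v : Euc N → ℝ) : ℝ :=
  max (X0Norm s p u) (X0Norm s p v)

/-- the critical exponent `p*_s(x) = N p̄(x)/(N − s p̄(x))`. -/
def pstar (N : ℕ) (s : ℝ) (p : Euc N × Euc N → ℝ) (x : Euc N) : ℝ :=
  (N : ℝ) * p (x, x) / ((N : ℝ) - s * p (x, x))

/-- `P(u,v)`. -/
def Pfun (s : ℝ) (p : Euc N × Euc N → ℝ) (u v : Euc N → ℝ) : ℝ :=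
  ∫ z : Euc N × Euc N,
    (|u z.1 - u z.2| ^ p z + |v z.1 - v z.2| ^ p z) / ‖z.1 - z.2‖ ^ ((N : ℝ) + s * p z)

/-- `Q(u,v)`. -/
def Qfun (Ω : Set (Euc N)) (q a b : Euc N → ℝ) (lam mu : ℝ) (u v : Euc N → ℝ) : ℝ :=
  ∫ x in Ω, (lam * a x * |u x| ^ q x + mu * b x * |v x| ^ q x)

/-- `R(u,v)`. -/
def Rfun (Ω : Set (Euc N)) (α β c : Euc N → ℝ) (u v : Euc N → ℝ) : ℝ :=
  ∫ x in Ω, c x * |u x| ^ α x * |v x| ^ β x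

/-- the energy functional `J_{λ,μ}`. -/
def Jfun (Ω : Set (Euc N)) (s : ℝ) (p : Euc N × Euc N → ℝ) (q α β a b c : Euc N → ℝ)
    (lam mu : ℝ) (u v : Euc N → ℝ) : ℝ :=
  (∫ z : Euc N × Euc N,
      (|u z.1 - u z.2| ^ p z + |v z.1 - v z.2| ^ p z) /
        (p z * ‖z.1 - z.2‖ ^ ((N : ℝ) + s * p z)))
  - (∫ x in Ω, (lam * a x * |u x| ^ q x + mu * b x * |v x| ^ q x) / q x)
  - ∫ x in Ω, c x * |u x| ^ α x * |v x| ^ β x / (α x + β x)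

/-- `φ''_{u,v}(1)`, the second derivative at `t = 1` of the fibering map. -/
def phiSecond (Ω : Set (Euc N)) (s : ℝ) (p : Euc N × Euc N → ℝ) (q α β a b c : Euc N → ℝ)
    (lam mu : ℝ) (u v : Euc N → ℝ) : ℝ :=
  (∫ z : Euc N × Euc N,
      (p z - 1) * (|u z.1 - u z.2| ^ p z + |v z.1 - v z.2| ^ p z) /
        ‖z.1 - z.2‖ ^ ((N : ℝ) + s * p z))
  - (∫ x in Ω, (q x - 1) * (lam * a x * |u x| ^ q x + mu * b x * |v x| ^ q x))
  - ∫ x in Ω, (α x + β x - 1) * (c x * |u x| ^ α x * |v x| ^ β x)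

/-- `(u,v) ≠ (0,0)` in `E`. -/
def Nontriv (u v : Euc N → ℝ) : Prop :=
  ¬ (u =ᵐ[(volume : Measure (Euc N))] 0 ∧ v =ᵐ[(volume : Measure (Euc N))] 0)

/-- membership in the Nehari manifold `N_{λ,μ}`:
`⟨J'(u,v),(u,v)⟩ = P(u,v) − Q(u,v) − R(u,v) = 0`. -/
def InNehari (Ω : Set (Euc N)) (s : ℝ) (p : Euc N × Euc N → ℝ) (q α β a b c : Euc N → ℝ)
    (lam mu : ℝ) (u v : Euc N → ℝ) : Prop :=
  MemX0 Ω s p u ∧ MemX0 Ω s p v ∧ Nontriv u v ∧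
    Pfun s p u v - Qfun Ω q a b lam mu u v - Rfun Ω α β c u v = 0

/-- `N⁺_{λ,μ}`. -/
def InNPlus (Ω : Set (Euc N)) (s : ℝ) (p : Euc N × Euc N → ℝ) (q α β a b c : Euc N → ℝ)
    (lam mu : ℝ) (u v : Euc N → ℝ) : Prop :=
  InNehari Ω s p q α β a b c lam mu u v ∧ 0 < phiSecond Ω s p q α β a b c lam mu u v

/-- `N⁻_{λ,μ}`. -/
def InNMinus (Ω : Set (Euc N)) (s : ℝ) (p : Euc N × Euc N → ℝ) (q α β a b c : Euc N → ℝ)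
    (lam mu : ℝ) (u v : Euc N → ℝ) : Prop :=
  InNehari Ω s p q α β a b c lam mu u v ∧ phiSecond Ω s p q α β a b c lam mu u v < 0

/-- `N⁰_{λ,μ}`. -/
def InNZero (Ω : Set (Euc N)) (s : ℝ) (p : Euc N × Euc N → ℝ) (q α β a b c : Euc N → ℝ)
    (lam mu : ℝ) (u v : Euc N → ℝ) : Prop :=
  InNehari Ω s p q α β a b c lam mu u v ∧ phiSecond Ω s p q α β a b c lam mu u v = 0

/-- `(u,v)` is a weak solution of the system, i.e. `J'_{λ,μ}(u,v) = 0` in the dual of `E`. -/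
def IsWeakSolution (Ω : Set (Euc N)) (s : ℝ) (p : Euc N × Euc N → ℝ)
    (q α β a b c : Euc N → ℝ) (lam mu : ℝ) (u v : Euc N → ℝ) : Prop :=
  ∀ φ ψ : Euc N → ℝ, MemX0 Ω s p φ → MemX0 Ω s p ψ →
    ((∫ z : Euc N × Euc N,
        |u z.1 - u z.2| ^ (p z - 2) * (u z.1 - u z.2) * (φ z.1 - φ z.2) /
          ‖z.1 - z.2‖ ^ ((N : ℝ) + s * p z))
      + ∫ z : Euc N × Euc N,
          |v z.1 - v z.2| ^ (p z - 2) * (v z.1 - v z.2) * (ψ z.1 - ψ z.2) /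
            ‖z.1 - z.2‖ ^ ((N : ℝ) + s * p z))
    = (∫ x in Ω, (lam * a x * |u x| ^ (q x - 2) * u x * φ x
        + mu * b x * |v x| ^ (q x - 2) * v x * ψ x))
      + (∫ x in Ω, α x / (α x + β x) * c x * |u x| ^ (α x - 2) * u x * |v x| ^ β x * φ x)
      + ∫ x in Ω, β x / (α x + β x) * c x * |v x| ^ (α x - 2) * v x * |u x| ^ β x * ψ x

/-- the standing hypotheses: `Ω` a bounded domain, `s ∈ (0,1)`, (P1)–(P2) with `s p⁺ < N`,
and (A1)–(A4). -/
def HypAll (N : ℕ) (Ω : Set (Euc N)) (s : ℝ) (p : Euc N × Euc N → ℝ)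
    (q α β a b c : Euc N → ℝ) : Prop :=
  2 ≤ N ∧ IsOpen Ω ∧ Bornology.IsBounded Ω ∧ Ω.Nonempty ∧
  0 < s ∧ s < 1 ∧
  CPlus univ p ∧ (∀ x y : Euc N, p (x, y) = p (y, x)) ∧ s * supOn p univ < (N : ℝ) ∧
  CPlus (closure Ω) q ∧ CPlus (closure Ω) α ∧ CPlus (closure Ω) β ∧
  supOn q (closure Ω) < infOn p univ ∧
  supOn p univ < infOn α (closure Ω) + infOn β (closure Ω) ∧
  supOn α (closure Ω) + supOn β (closure Ω) < infOn (pstar N s p) (closure Ω) ∧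
  infOn p univ / (supOn α (closure Ω) + supOn β (closure Ω)) <
    (infOn p univ - supOn q (closure Ω)) /
        (supOn α (closure Ω) + supOn β (closure Ω) - supOn q (closure Ω)) *
      ((infOn α (closure Ω) + infOn β (closure Ω) - infOn q (closure Ω)) /
        (supOn p univ - infOn q (closure Ω))) ∧
  Measurable a ∧ Measurable b ∧ Measurable c ∧
  (∀ x, 0 ≤ a x) ∧ (∀ x, 0 ≤ b x) ∧ (∀ x, 0 ≤ c x) ∧
  MemVarLp Ω (fun x => (α x + β x) / (α x + β x - q x)) a ∧
  MemVarLp Ω (fun x => (α x + β x) / (α x + β x - q x)) b ∧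
  (∃ M : ℝ, ∀ x, c x ≤ M)

/-- the estimate `Q(u,v) ≤ C₁(λ+μ)·max{‖(u,v)‖^{q⁻},‖(u,v)‖^{q⁺}}`. -/
def QEstimate (Ω : Set (Euc N)) (s : ℝ) (p : Euc N × Euc N → ℝ) (q a b : Euc N → ℝ)
    (C₁ : ℝ) : Prop :=
  ∀ lam mu : ℝ, 0 < lam → 0 < mu → ∀ u v : Euc N → ℝ,
    MemX0 Ω s p u → MemX0 Ω s p v →
      Qfun Ω q a b lam mu u v ≤ C₁ * (lam + mu) *
        max (pairNorm s p u v ^ infOn q (closure Ω))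
          (pairNorm s p u v ^ supOn q (closure Ω))

/-- the estimate `R(u,v) ≤ C₂·max{‖(u,v)‖^{α⁻+β⁻},‖(u,v)‖^{α⁺+β⁺}}`. -/
def REstimate (Ω : Set (Euc N)) (s : ℝ) (p : Euc N × Euc N → ℝ) (α β c : Euc N → ℝ)
    (C₂ : ℝ) : Prop :=
  ∀ u v : Euc N → ℝ, MemX0 Ω s p u → MemX0 Ω s p v →
    Rfun Ω α β c u v ≤ C₂ *
      max (pairNorm s p u v ^ (infOn α (closure Ω) + infOn β (closure Ω)))
        (pairNorm s p u v ^ (supOn α (closure Ω) + supOn β (closure Ω)))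

/-- the threshold
`δ = (1/C₁)·[(α⁻+β⁻−p⁺)/(α⁻+β⁻−q⁻)]·[(p⁻−q⁺)/(C₂(α⁺+β⁺−q⁺))]^{(p⁺−q⁻)/(α⁻+β⁻−p⁺)}`. -/
def deltaConst (Ω : Set (Euc N)) (p : Euc N × Euc N → ℝ) (q α β : Euc N → ℝ)
    (C₁ C₂ : ℝ) : ℝ :=
  (1 / C₁) *
    ((infOn α (closure Ω) + infOn β (closure Ω) - supOn p univ) /
      (infOn α (closure Ω) + infOn β (closure Ω) - infOn q (closure Ω))) *
    ((infOn p univ - supOn q (closure Ω)) /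
        (C₂ * (supOn α (closure Ω) + supOn β (closure Ω) - supOn q (closure Ω)))) ^
      ((supOn p univ - infOn q (closure Ω)) /
        (infOn α (closure Ω) + infOn β (closure Ω) - supOn p univ))

/-- scaling `t·u`. -/
def scale (t : ℝ) (u : Euc N → ℝ) : Euc N → ℝ := fun x => t * u x

/-- weak convergence `u_m ⇀ u` in `X₀`, tested through the isometric embedding
`u ↦ (u(x)−u(y))` of `X₀` into `L^{p(x,y)}(dx dy/|x−y|^{N+sp(x,y)})`. -/
def WeakTendstoX0 (s : ℝ) (p : Euc N × Euc N → ℝ) (um : ℕ → Euc N → ℝ)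
    (u : Euc N → ℝ) : Prop :=
  ∀ g : Euc N × Euc N → ℝ, Measurable g →
    Integrable (fun z : Euc N × Euc N =>
      |g z| ^ (p z / (p z - 1)) / ‖z.1 - z.2‖ ^ ((N : ℝ) + s * p z)) →
    Tendsto (fun m => ∫ z : Euc N × Euc N,
        (um m z.1 - um m z.2) * g z / ‖z.1 - z.2‖ ^ ((N : ℝ) + s * p z)) atTop
      (𝓝 (∫ z : Euc N × Euc N, (u z.1 - u z.2) * g z / ‖z.1 - z.2‖ ^ ((N : ℝ) + s * p z)))

lemma CPlus.infOn_le {X : Type*} [TopologicalSpace X] {D : Set X} {g : X → ℝ} (hg : CPlus D g)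
    {x : X} (hx : x ∈ D) : infOn g D ≤ g x := by
  refine csInf_le ?_ (mem_image_of_mem g hx)
  by_contra hb
  have h0 : infOn g D = 0 := Real.sInf_of_not_bddBelow hb
  linarith [hg.2.1]

lemma CPlus.le_supOn {X : Type*} [TopologicalSpace X] {D : Set X} {g : X → ℝ} (hg : CPlus D g)
    {x : X} (hx : x ∈ D) : g x ≤ supOn g D :=
  le_csSup hg.2.2 (mem_image_of_mem g hx)

lemma CPlus.infOn_le_supOn {X : Type*} [TopologicalSpace X] {D : Set X} {g : X → ℝ}
    (hg : CPlus D g) (hD : D.Nonempty) : infOn g D ≤ supOn g D := by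
  obtain ⟨x, hx⟩ := hD
  exact (hg.infOn_le hx).trans (hg.le_supOn hx)

lemma CPlus.aestronglyMeasurable {Ω : Set (Euc N)} {g : Euc N → ℝ} (hg : CPlus (closure Ω) g)
    (hΩ : IsOpen Ω) : AEStronglyMeasurable g (volume.restrict Ω) :=
  (hg.1.mono subset_closure).aestronglyMeasurable hΩ.measurableSet

section Weighted

variable {X : Type*} [MeasurableSpace X] {ν : Measure X} {w f : X → ℝ} {m M : ℝ}

lemma MeasureTheory.Integrable.weight_mul (hf : Integrable f ν) (hw : AEStronglyMeasurable w ν)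
    (hm : 0 < m) (hmw : ∀ᵐ x ∂ν, m ≤ w x) (hwM : ∀ᵐ x ∂ν, w x ≤ M) :
    Integrable (fun x => w x * f x) ν := by
  refine hf.bdd_mul (c := M) hw ?_
  filter_upwards [hmw, hwM] with x h1 h2
  rwa [Real.norm_eq_abs, abs_of_pos (hm.trans_le h1)]

lemma integrable_weight_mul_iff (hw : AEStronglyMeasurable w ν)
    (hm : 0 < m) (hmw : ∀ᵐ x ∂ν, m ≤ w x) (hwM : ∀ᵐ x ∂ν, w x ≤ M) :
    Integrable (fun x => w x * f x) ν ↔ Integrable f ν := by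
  refine ⟨fun h => ?_, fun h => h.weight_mul hw hm hmw hwM⟩
  have h' : Integrable (fun x => (w x)⁻¹ * (w x * f x)) ν := by
    refine h.bdd_mul (c := m⁻¹) hw.aemeasurable.inv.aestronglyMeasurable ?_
    filter_upwards [hmw] with x h1
    rw [Real.norm_eq_abs, abs_of_pos (inv_pos.2 (hm.trans_le h1))]
    exact inv_anti₀ hm h1
  refine h'.congr ?_
  filter_upwards [hmw] with x h1
  exact inv_mul_cancel_left₀ (hm.trans_le h1).ne' _

/-- No integrability is needed: `w * f` and `f` are integrable or not together. -/
lemma integral_weight_mul_bounds (hw : AEStronglyMeasurable w ν)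
    (hm : 0 < m) (hmw : ∀ᵐ x ∂ν, m ≤ w x) (hwM : ∀ᵐ x ∂ν, w x ≤ M) (hf : ∀ x, 0 ≤ f x) :
    m * ∫ x, f x ∂ν ≤ ∫ x, w x * f x ∂ν ∧ ∫ x, w x * f x ∂ν ≤ M * ∫ x, f x ∂ν := by
  have hiff := integrable_weight_mul_iff (f := f) hw hm hmw hwM
  by_cases hi : Integrable f ν
  · rw [← integral_const_mul, ← integral_const_mul]
    constructor
    · refine integral_mono_ae (hi.const_mul m) (hiff.2 hi) ?_
      filter_upwards [hmw] with x h1 using mul_le_mul_of_nonneg_right h1 (hf x)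
    · refine integral_mono_ae (hiff.2 hi) (hi.const_mul M) ?_
      filter_upwards [hwM] with x h1 using mul_le_mul_of_nonneg_right h1 (hf x)
  · rw [integral_undef hi, integral_undef (mt hiff.1 hi)]
    simp

lemma integral_div_weight_bounds (hw : AEStronglyMeasurable w ν)
    (hm : 0 < m) (hmw : ∀ᵐ x ∂ν, m ≤ w x) (hwM : ∀ᵐ x ∂ν, w x ≤ M) (hf : ∀ x, 0 ≤ f x) :
    M⁻¹ * ∫ x, f x ∂ν ≤ ∫ x, f x / w x ∂ν ∧ ∫ x, f x / w x ∂ν ≤ m⁻¹ * ∫ x, f x ∂ν := by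
  rcases eq_or_ne ν 0 with rfl | hν
  · simp
  have hM : 0 < M := by
    have := ae_neBot.2 hν
    obtain ⟨x, h1, h2⟩ := (hmw.and hwM).exists
    exact hm.trans_le (h1.trans h2)
  simp only [div_eq_inv_mul]
  refine integral_weight_mul_bounds hw.aemeasurable.inv.aestronglyMeasurable (inv_pos.2 hM)
    ?_ ?_ hf
  · filter_upwards [hmw, hwM] with x h1 h2 using inv_anti₀ (hm.trans_le h1) h2
  · filter_upwards [hmw] with x h1 using inv_anti₀ hm h1

end Weighted

lemma rpow_le_max_rpow {η x y r : ℝ} (hη : 0 < η) (hx : x ≤ r) (hy : r ≤ y) :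
    η ^ r ≤ max (η ^ x) (η ^ y) := by
  rcases le_total 1 η with h | h
  · exact (Real.rpow_le_rpow_of_exponent_le h hy).trans (le_max_right _ _)
  · exact (Real.rpow_le_rpow_of_exponent_ge hη h hx).trans (le_max_left _ _)

lemma min_rpow_le_rpow {η x y r : ℝ} (hη : 0 < η) (hx : x ≤ r) (hy : r ≤ y) :
    min (η ^ x) (η ^ y) ≤ η ^ r := by
  rcases le_total 1 η with h | h
  · exact (min_le_left _ _).trans (Real.rpow_le_rpow_of_exponent_le h hx)
  · exact (min_le_right _ _).trans (Real.rpow_le_rpow_of_exponent_ge hη h hy)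

section Gagliardo

variable {s : ℝ} {p : Euc N × Euc N → ℝ} {u v : Euc N → ℝ} {Ω : Set (Euc N)}

lemma gagliardo_integrand_nonneg (s : ℝ) (p : Euc N × Euc N → ℝ) (u : Euc N → ℝ)
    (z : Euc N × Euc N) :
    0 ≤ |u z.1 - u z.2| ^ p z / ‖z.1 - z.2‖ ^ ((N : ℝ) + s * p z) := by positivity

lemma aestronglyMeasurable_inv_rpow (hp : CPlus univ p) {η : ℝ} (hη : 0 < η) :
    AEStronglyMeasurable (fun z => (η ^ p z)⁻¹) (volume : Measure (Euc N × Euc N)) := by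
  have hpc : Continuous p := continuousOn_univ.1 hp.1
  have : Continuous fun z => η ^ p z := continuous_const.rpow hpc fun _ => .inl hη.ne'
  exact (this.inv₀ fun z => (Real.rpow_pos_of_pos hη _).ne').aestronglyMeasurable

lemma le_inv_rpow (hp : CPlus univ p) {η : ℝ} (hη : 0 < η) (z : Euc N × Euc N) :
    (max (η ^ infOn p univ) (η ^ supOn p univ))⁻¹ ≤ (η ^ p z)⁻¹ :=
  inv_anti₀ (Real.rpow_pos_of_pos hη _)
    (rpow_le_max_rpow hη (hp.infOn_le (mem_univ z)) (hp.le_supOn (mem_univ z)))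

lemma inv_rpow_le (hp : CPlus univ p) {η : ℝ} (hη : 0 < η) (z : Euc N × Euc N) :
    (η ^ p z)⁻¹ ≤ (min (η ^ infOn p univ) (η ^ supOn p univ))⁻¹ :=
  inv_anti₀ (lt_min (Real.rpow_pos_of_pos hη _) (Real.rpow_pos_of_pos hη _))
    (min_rpow_le_rpow hη (hp.infOn_le (mem_univ z)) (hp.le_supOn (mem_univ z)))

lemma MemX0.integrable (hp : CPlus univ p) (hu : MemX0 Ω s p u) :
    Integrable (fun z : Euc N × Euc N =>
      |u z.1 - u z.2| ^ p z / ‖z.1 - z.2‖ ^ ((N : ℝ) + s * p z)) := by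
  obtain ⟨-, -, η, hη, hi⟩ := hu
  refine (integrable_weight_mul_iff (aestronglyMeasurable_inv_rpow hp hη)
    (inv_pos.2 (lt_max_of_lt_left (Real.rpow_pos_of_pos hη _)))
    (.of_forall (le_inv_rpow hp hη)) (.of_forall (inv_rpow_le hp hη))).1 ?_
  refine hi.congr (.of_forall fun z => ?_)
  simp only [div_eq_mul_inv, mul_inv]
  ring

lemma min_rpow_le_rhoX0_of_lt (hp : CPlus univ p) {η : ℝ} (hη : 0 < η)
    (hlt : η < X0Norm s p u) :
    min (η ^ infOn p univ) (η ^ supOn p univ) ≤ rhoX0 s p u := by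
  have h1 : 1 < gagliardoOn univ s p u η := by
    by_contra! h
    exact hlt.not_ge (csInf_le ⟨0, fun _ hx => hx.1.le⟩ ⟨hη, h⟩)
  have h2 := (integral_weight_mul_bounds (aestronglyMeasurable_inv_rpow hp hη)
    (inv_pos.2 (lt_max_of_lt_left (Real.rpow_pos_of_pos hη _)))
    (.of_forall (le_inv_rpow hp hη)) (.of_forall (inv_rpow_le hp hη))
    (gagliardo_integrand_nonneg s p u)).2
  have h3 : gagliardoOn univ s p u η = ∫ z : Euc N × Euc N, (η ^ p z)⁻¹ *
      (|u z.1 - u z.2| ^ p z / ‖z.1 - z.2‖ ^ ((N : ℝ) + s * p z)) := by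
    rw [gagliardoOn, setIntegral_univ]
    refine integral_congr_ae (.of_forall fun z => ?_)
    simp only [div_eq_mul_inv, mul_inv]
    ring
  rw [← h3] at h2
  have h4 := h1.le.trans h2
  rwa [inv_mul_eq_div, one_le_div
    (lt_min (Real.rpow_pos_of_pos hη _) (Real.rpow_pos_of_pos hη _))] at h4

lemma X0Norm_nonneg (s : ℝ) (p : Euc N × Euc N → ℝ) (u : Euc N → ℝ) : 0 ≤ X0Norm s p u :=
  Real.sInf_nonneg fun _ hx => hx.1.le

lemma rhoX0_nonneg (s : ℝ) (p : Euc N × Euc N → ℝ) (u : Euc N → ℝ) : 0 ≤ rhoX0 s p u :=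
  integral_nonneg (gagliardo_integrand_nonneg s p u)

lemma min_rpow_X0Norm_le_rhoX0 (hp : CPlus univ p) :
    min (X0Norm s p u ^ infOn p univ) (X0Norm s p u ^ supOn p univ) ≤ rhoX0 s p u := by
  have hinf : 0 < infOn p univ := by linarith [hp.2.1]
  have hsup : 0 < supOn p univ := hinf.trans_le (hp.infOn_le_supOn univ_nonempty)
  rcases (X0Norm_nonneg s p u).eq_or_lt with h0 | h0
  · rw [← h0, Real.zero_rpow hinf.ne', Real.zero_rpow hsup.ne', min_self]
    exact rhoX0_nonneg s p u
  · have hc : Continuous fun η : ℝ => min (η ^ infOn p univ) (η ^ supOn p univ) :=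
      (Real.continuous_rpow_const hinf.le).min (Real.continuous_rpow_const hsup.le)
    refine le_of_tendsto (hc.continuousWithinAt (s := Iio (X0Norm s p u))) ?_
    filter_upwards [Ioo_mem_nhdsLT h0] with η hη using min_rpow_le_rhoX0_of_lt hp hη.1 hη.2

lemma Pfun_eq_add (hp : CPlus univ p) (hu : MemX0 Ω s p u) (hv : MemX0 Ω s p v) :
    Pfun s p u v = rhoX0 s p u + rhoX0 s p v := by
  rw [Pfun, rhoX0, rhoX0, ← integral_add (hu.integrable hp) (hv.integrable hp)]
  simp only [add_div]

lemma min_rpow_pairNorm_le_Pfun (hp : CPlus univ p) (hu : MemX0 Ω s p u)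
    (hv : MemX0 Ω s p v) :
    min (pairNorm s p u v ^ infOn p univ) (pairNorm s p u v ^ supOn p univ) ≤ Pfun s p u v := by
  rw [Pfun_eq_add hp hu hv, pairNorm]
  rcases max_choice (X0Norm s p u) (X0Norm s p v) with h | h <;> rw [h]
  · linarith [min_rpow_X0Norm_le_rhoX0 (s := s) (u := u) hp, rhoX0_nonneg s p v]
  · linarith [min_rpow_X0Norm_le_rhoX0 (s := s) (u := v) hp, rhoX0_nonneg s p u]

end Gagliardo

section Functional

variable {Ω : Set (Euc N)} {s : ℝ} {p : Euc N × Euc N → ℝ} {q α β a b c u v : Euc N → ℝ}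
  {lam mu : ℝ}

lemma le_Jfun (hΩ : IsOpen Ω) (hp : CPlus univ p) (hq : CPlus (closure Ω) q)
    (hα : CPlus (closure Ω) α) (hβ : CPlus (closure Ω) β)
    (ha : ∀ x, 0 ≤ a x) (hb : ∀ x, 0 ≤ b x) (hc : ∀ x, 0 ≤ c x)
    (hlam : 0 < lam) (hmu : 0 < mu) :
    (supOn p univ)⁻¹ * Pfun s p u v - (infOn q (closure Ω))⁻¹ * Qfun Ω q a b lam mu u v
      - (infOn α (closure Ω) + infOn β (closure Ω))⁻¹ * Rfun Ω α β c u v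
      ≤ Jfun Ω s p q α β a b c lam mu u v := by
  have hΩm := hΩ.measurableSet
  have hP := (integral_div_weight_bounds (ν := (volume : Measure (Euc N × Euc N)))
    (w := p) (m := infOn p univ)
    (f := fun z => (|u z.1 - u z.2| ^ p z + |v z.1 - v z.2| ^ p z) /
      ‖z.1 - z.2‖ ^ ((N : ℝ) + s * p z))
    (continuousOn_univ.1 hp.1).aestronglyMeasurable (by linarith [hp.2.1])
    (.of_forall fun z => hp.infOn_le (mem_univ z))
    (.of_forall fun z => hp.le_supOn (mem_univ z)) (fun z => by positivity)).1
  have hQ := (integral_div_weight_bounds (ν := volume.restrict Ω)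
    (w := q) (m := infOn q (closure Ω))
    (f := fun x => lam * a x * |u x| ^ q x + mu * b x * |v x| ^ q x)
    (hq.aestronglyMeasurable hΩ) (by linarith [hq.2.1])
    (ae_restrict_of_forall_mem hΩm fun x hx => hq.infOn_le (subset_closure hx))
    (ae_restrict_of_forall_mem hΩm fun x hx => hq.le_supOn (subset_closure hx))
    (fun x => by have := ha x; have := hb x; positivity)).2
  have hR := (integral_div_weight_bounds (ν := volume.restrict Ω)
    (w := fun x => α x + β x) (m := infOn α (closure Ω) + infOn β (closure Ω))
    (f := fun x => c x * |u x| ^ α x * |v x| ^ β x)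
    ((hα.aestronglyMeasurable hΩ).add (hβ.aestronglyMeasurable hΩ))
    (by linarith [hα.2.1, hβ.2.1])
    (ae_restrict_of_forall_mem hΩm fun x hx =>
      add_le_add (hα.infOn_le (subset_closure hx)) (hβ.infOn_le (subset_closure hx)))
    (ae_restrict_of_forall_mem hΩm fun x hx =>
      add_le_add (hα.le_supOn (subset_closure hx)) (hβ.le_supOn (subset_closure hx)))
    (fun x => by have := hc x; positivity)).2
  unfold Jfun Pfun Qfun Rfun
  simp only [div_mul_eq_div_div_swap]
  linarith

lemma le_phiSecond (hΩ : IsOpen Ω) (hp : CPlus univ p) (hq : CPlus (closure Ω) q)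
    (hα : CPlus (closure Ω) α) (hβ : CPlus (closure Ω) β)
    (ha : ∀ x, 0 ≤ a x) (hb : ∀ x, 0 ≤ b x) (hc : ∀ x, 0 ≤ c x)
    (hlam : 0 < lam) (hmu : 0 < mu) :
    (infOn p univ - 1) * Pfun s p u v - (supOn q (closure Ω) - 1) * Qfun Ω q a b lam mu u v
      - (supOn α (closure Ω) + supOn β (closure Ω) - 1) * Rfun Ω α β c u v
      ≤ phiSecond Ω s p q α β a b c lam mu u v := by
  have hΩm := hΩ.measurableSet
  have hP := (integral_weight_mul_bounds (ν := (volume : Measure (Euc N × Euc N)))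
    (w := fun z => p z - 1) (m := infOn p univ - 1) (M := supOn p univ - 1)
    (f := fun z => (|u z.1 - u z.2| ^ p z + |v z.1 - v z.2| ^ p z) /
      ‖z.1 - z.2‖ ^ ((N : ℝ) + s * p z))
    ((continuousOn_univ.1 hp.1).sub continuous_const).aestronglyMeasurable
    (by linarith [hp.2.1])
    (.of_forall fun z => sub_le_sub_right (hp.infOn_le (mem_univ z)) 1)
    (.of_forall fun z => sub_le_sub_right (hp.le_supOn (mem_univ z)) 1)
    (fun z => by positivity)).1
  have hQ := (integral_weight_mul_bounds (ν := volume.restrict Ω)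
    (w := fun x => q x - 1) (m := infOn q (closure Ω) - 1) (M := supOn q (closure Ω) - 1)
    (f := fun x => lam * a x * |u x| ^ q x + mu * b x * |v x| ^ q x)
    ((hq.aestronglyMeasurable hΩ).sub aestronglyMeasurable_const) (by linarith [hq.2.1])
    (ae_restrict_of_forall_mem hΩm fun x hx =>
      sub_le_sub_right (hq.infOn_le (subset_closure hx)) 1)
    (ae_restrict_of_forall_mem hΩm fun x hx =>
      sub_le_sub_right (hq.le_supOn (subset_closure hx)) 1)
    (fun x => by have := ha x; have := hb x; positivity)).2
  have hR := (integral_weight_mul_bounds (ν := volume.restrict Ω)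
    (w := fun x => α x + β x - 1) (m := infOn α (closure Ω) + infOn β (closure Ω) - 1)
    (M := supOn α (closure Ω) + supOn β (closure Ω) - 1)
    (f := fun x => c x * |u x| ^ α x * |v x| ^ β x)
    (((hα.aestronglyMeasurable hΩ).add (hβ.aestronglyMeasurable hΩ)).sub
      aestronglyMeasurable_const)
    (by linarith [hα.2.1, hβ.2.1])
    (ae_restrict_of_forall_mem hΩm fun x hx => sub_le_sub_right
      (add_le_add (hα.infOn_le (subset_closure hx)) (hβ.infOn_le (subset_closure hx))) 1)
    (ae_restrict_of_forall_mem hΩm fun x hx => sub_le_sub_right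
      (add_le_add (hα.le_supOn (subset_closure hx)) (hβ.le_supOn (subset_closure hx))) 1)
    (fun x => by have := hc x; positivity)).2
  simp only [← mul_div_assoc] at hP
  unfold phiSecond Pfun Qfun Rfun
  linarith

end Functional

/-- The scalar inequality behind the lower bound on `N⁻`: `t` is the norm of the pair, and `P`,
`Q`, `R` are the values of the three functionals. -/
lemma nehari_minus_energy_lower_bound {pm pp qm qp rm rp C₁ C₂ L A D t P Q R : ℝ}
    (hqm : 0 < qm) (hq : qm ≤ qp) (hqp : qp < pm) (hp : pm ≤ pp) (hpr : pp < rm) (hr : rm ≤ rp)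
    (hC₂ : 1 < C₂)
    (hA : A = (pm - qp) / (C₂ * (rp - qp)))
    (hD : D = (pp⁻¹ - rm⁻¹) * A ^ ((pp - qm) / (rm - pp)) - (qm⁻¹ - rm⁻¹) * (C₁ * L))
    (hD0 : 0 < D) (ht : 0 ≤ t)
    (hP : min (t ^ pm) (t ^ pp) ≤ P)
    (hQ : Q ≤ C₁ * L * max (t ^ qm) (t ^ qp))
    (hR : R ≤ C₂ * max (t ^ rm) (t ^ rp))
    (hN : P - Q - R = 0)
    (hphi : (pm - 1) * P - (qp - 1) * Q - (rp - 1) * R < 0) :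
    (A ^ (rm - pp)⁻¹) ^ qm * D ≤ pp⁻¹ * P - qm⁻¹ * Q - rm⁻¹ * R := by
  have hrp : 0 < rp - qp := by linarith
  have hA0 : 0 < A := by rw [hA]; apply div_pos <;> nlinarith
  have hA1 : A < 1 := by rw [hA, div_lt_one (by nlinarith)]; nlinarith
  have hPR : (pm - qp) * P < (rp - qp) * R := by
    have : Q = P - R := by linarith
    rw [this] at hphi
    linarith
  have hPR' : A * P < max (t ^ rm) (t ^ rp) := by
    have : (pm - qp) * P < (rp - qp) * (C₂ * max (t ^ rm) (t ^ rp)) :=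
      hPR.trans_le (mul_le_mul_of_nonneg_left hR hrp.le)
    rw [hA, div_mul_eq_mul_div, div_lt_iff₀ (by nlinarith)]
    linarith
  have ht0 : 0 < t := by
    refine ht.lt_of_ne fun h0 => ?_
    rw [← h0, Real.zero_rpow (by linarith), Real.zero_rpow (by linarith), max_self] at hPR'
    rw [← h0, Real.zero_rpow (by linarith), Real.zero_rpow (by linarith), min_self] at hP
    nlinarith
  have hcP : 0 < pp⁻¹ - rm⁻¹ := sub_pos.2 (inv_strictAnti₀ (by linarith) hpr)
  have hcQ : 0 < qm⁻¹ - rm⁻¹ := sub_pos.2 (inv_strictAnti₀ hqm (by linarith))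
  have hJ : pp⁻¹ * P - qm⁻¹ * Q - rm⁻¹ * R = (pp⁻¹ - rm⁻¹) * P - (qm⁻¹ - rm⁻¹) * Q := by
    have : R = P - Q := by linarith
    rw [this]; ring
  have hr0 : 0 < (rm - pp)⁻¹ := inv_pos.2 (by linarith)
  have hB0 : 0 < A ^ (rm - pp)⁻¹ := Real.rpow_pos_of_pos hA0 _
  have hB1 : A ^ (rm - pp)⁻¹ ≤ 1 := Real.rpow_le_one hA0.le hA1.le hr0.le
  have key : ∀ x y : ℝ, t ^ x ≤ P → Q ≤ C₁ * L * t ^ y →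
      A ^ ((pp - qm) / (rm - pp)) ≤ t ^ (x - y) → (A ^ (rm - pp)⁻¹) ^ qm ≤ t ^ y →
      (A ^ (rm - pp)⁻¹) ^ qm * D ≤ (pp⁻¹ - rm⁻¹) * P - (qm⁻¹ - rm⁻¹) * Q := by
    intro x y h1 h2 h3 h4
    have hxy : t ^ x = t ^ y * t ^ (x - y) := by
      rw [← Real.rpow_add ht0, add_sub_cancel]
    have hy : 0 < t ^ y := Real.rpow_pos_of_pos ht0 y
    calc (A ^ (rm - pp)⁻¹) ^ qm * D ≤ t ^ y * D := mul_le_mul_of_nonneg_right h4 hD0.le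
      _ = (pp⁻¹ - rm⁻¹) * (t ^ y * A ^ ((pp - qm) / (rm - pp)))
          - (qm⁻¹ - rm⁻¹) * (C₁ * L * t ^ y) := by rw [hD]; ring
      _ ≤ (pp⁻¹ - rm⁻¹) * P - (qm⁻¹ - rm⁻¹) * Q := by
        refine sub_le_sub (mul_le_mul_of_nonneg_left ?_ hcP.le)
          (mul_le_mul_of_nonneg_left h2 hcQ.le)
        exact (mul_le_mul_of_nonneg_left h3 hy.le).trans (hxy ▸ h1)
  rw [hJ]
  rcases le_total 1 t with h1 | h1
  · have le1 : ∀ {x y : ℝ}, x ≤ y → t ^ x ≤ t ^ y := Real.rpow_le_rpow_of_exponent_le h1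
    rw [min_eq_left (le1 hp)] at hP
    rw [max_eq_right (le1 hq)] at hQ
    refine key pm qp hP hQ ?_ ?_
    · exact (Real.rpow_le_one hA0.le hA1.le (div_nonneg (by linarith) (by linarith))).trans
        (Real.one_le_rpow h1 (by linarith))
    · exact (Real.rpow_le_one hB0.le hB1 hqm.le).trans (Real.one_le_rpow h1 (by linarith))
  · have le1 : ∀ {x y : ℝ}, x ≤ y → t ^ y ≤ t ^ x := Real.rpow_le_rpow_of_exponent_ge ht0 h1
    rw [min_eq_right (le1 hp)] at hP
    rw [max_eq_left (le1 hq)] at hQ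
    rw [max_eq_left (le1 hr)] at hPR'
    have hAt : A ≤ t ^ (rm - pp) := by
      have h2 : A * t ^ pp < t ^ rm := (mul_le_mul_of_nonneg_left hP hA0.le).trans_lt hPR'
      rw [Real.rpow_sub ht0, le_div_iff₀ (Real.rpow_pos_of_pos ht0 _)]
      exact h2.le
    have hBt : A ^ (rm - pp)⁻¹ ≤ t := by
      refine (Real.rpow_le_rpow hA0.le hAt hr0.le).trans_eq ?_
      rw [Real.rpow_rpow_inv ht0.le (by linarith)]
    refine key pp qm hP hQ ?_ (Real.rpow_le_rpow hB0.le hBt hqm.le)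
    rw [div_eq_inv_mul, Real.rpow_mul hA0.le]
    exact Real.rpow_le_rpow hB0.le hBt (by linarith)

/-- for `λ + μ < (q⁻/p⁺)·δ` one has `θ⁻_{λ,μ} ≥ K > 0`. -/
theorem theta_minus_pos
    (N : ℕ) (Ω : Set (Euc N)) (s : ℝ) (p : Euc N × Euc N → ℝ)
    (q α β a b c : Euc N → ℝ) (h : HypAll N Ω s p q α β a b c)
    (C₁ C₂ : ℝ) (hC₁ : 0 < C₁) (hC₂ : 1 < C₂)
    (hQ : QEstimate Ω s p q a b C₁) (hR : REstimate Ω s p α β c C₂)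
    (lam mu : ℝ) (hlam : 0 < lam) (hmu : 0 < mu)
    (hlm : lam + mu <
      (infOn q (closure Ω) / supOn p univ) * deltaConst Ω p q α β C₁ C₂) :
    ∃ K > (0 : ℝ),
      (∀ u v : Euc N → ℝ, InNMinus Ω s p q α β a b c lam mu u v →
        K ≤ Jfun Ω s p q α β a b c lam mu u v) ∧
      ∀ u v : Euc N → ℝ, InNMinus Ω s p q α β a b c lam mu u v →
        0 < Jfun Ω s p q α β a b c lam mu u v := by
  obtain ⟨-, hΩ, -, hne, -, -, hp, -, -, hq, hα, hβ, hqp, hpr, -, -, -, -, -, ha, hb, hc, -, -, -⟩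
    := h
  have hq1 := hq.2.1
  have hqq := hq.infOn_le_supOn hne.closure
  have hpp := hp.infOn_le_supOn univ_nonempty
  have hrr := add_le_add (hα.infOn_le_supOn hne.closure) (hβ.infOn_le_supOn hne.closure)
  rw [deltaConst] at hlm
  set pm := infOn p univ
  set pp := supOn p univ
  set qm := infOn q (closure Ω)
  set qp := supOn q (closure Ω)
  set rm := infOn α (closure Ω) + infOn β (closure Ω)
  set rp := supOn α (closure Ω) + supOn β (closure Ω)
  set A := (pm - qp) / (C₂ * (rp - qp)) with hA
  set D := (pp⁻¹ - rm⁻¹) * A ^ ((pp - qm) / (rm - pp)) - (qm⁻¹ - rm⁻¹) * (C₁ * (lam + mu))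
    with hD
  have hA0 : 0 < A := div_pos (by linarith) (mul_pos (by linarith) (by linarith))
  have hD0 : 0 < D := by
    have hqm0 : 0 < qm := by linarith
    have hpp0 : 0 < pp := by linarith
    have hrm0 : 0 < rm := by linarith
    have hrq : 0 < rm - qm := by linarith
    have hc0 : 0 < (qm⁻¹ - rm⁻¹) * C₁ :=
      mul_pos (sub_pos.2 (inv_strictAnti₀ hqm0 (by linarith))) hC₁
    have h1 := mul_lt_mul_of_pos_left hlm hc0
    have h2 : (qm⁻¹ - rm⁻¹) * C₁ * (qm / pp * (1 / C₁ * ((rm - pp) / (rm - qm)) *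
        A ^ ((pp - qm) / (rm - pp)))) = (pp⁻¹ - rm⁻¹) * A ^ ((pp - qm) / (rm - pp)) := by
      field_simp
    rw [h2] at h1
    rw [hD]
    linarith
  have hK : 0 < (A ^ (rm - pp)⁻¹) ^ qm * D := by positivity
  have hbound : ∀ u v : Euc N → ℝ, InNMinus Ω s p q α β a b c lam mu u v →
      (A ^ (rm - pp)⁻¹) ^ qm * D ≤ Jfun Ω s p q α β a b c lam mu u v := by
    rintro u v ⟨⟨hu, hv, -, hN⟩, hphi⟩
    exact (nehari_minus_energy_lower_bound (by linarith) hqq hqp hpp hpr hrr hC₂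
      hA hD hD0 ((X0Norm_nonneg s p u).trans (le_max_left _ _))
      (min_rpow_pairNorm_le_Pfun hp hu hv) (hQ lam mu hlam hmu u v hu hv) (hR u v hu hv) hN
      ((le_phiSecond hΩ hp hq hα hβ ha hb hc hlam hmu).trans_lt hphi)).trans
      (le_Jfun hΩ hp hq hα hβ ha hb hc hlam hmu)
  exact ⟨_, hK, hbound, fun u v huv => hK.trans_le (hbound u v huv)⟩
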